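/- arXiv:2404.12951 — 2 statements merged into one kernel-verified Lean document; each statement's English description precedes it below -/
import Mathlib

section
/- (Factorization for the distant Bang calculus.) In λ!, full reduction factorizes through surface followed by internal reduction: →F* = →S* ∘ →I*, i.e. t →F* u if and only if there exists s with t →S* s and s →I* u. -/
namespace BangPaper

/-! ### Generic rewriting notions -/

/-- `a` is a normal form for the relation `r`. -/
def IsNF {α : Type*} (r : α → α → Prop) (a : α) : Prop := ∀ b, ¬ r a b

/-- Reflexive-transitive closure of the union of two relations,
counting the number of steps of each. -/
inductive Counted2 {α : Type*} (r₁ r₂ : α → α → Prop) : ℕ → ℕ → α → α → Prop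
  | refl (t : α) : Counted2 r₁ r₂ 0 0 t t
  | step₁ {t u v : α} {m n : ℕ} :
      r₁ t u → Counted2 r₁ r₂ m n u v → Counted2 r₁ r₂ (m + 1) n t v
  | step₂ {t u v : α} {m n : ℕ} :
      r₂ t u → Counted2 r₁ r₂ m n u v → Counted2 r₁ r₂ m (n + 1) t v

/-- Reflexive-transitive closure of the union of three relations,
counting the number of steps of each. -/
inductive Counted3 {α : Type*} (r₁ r₂ r₃ : α → α → Prop) : ℕ → ℕ → ℕ → α → α → Prop
  | refl (t : α) : Counted3 r₁ r₂ r₃ 0 0 0 t t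
  | step₁ {t u v : α} {m n k : ℕ} :
      r₁ t u → Counted3 r₁ r₂ r₃ m n k u v → Counted3 r₁ r₂ r₃ (m + 1) n k t v
  | step₂ {t u v : α} {m n k : ℕ} :
      r₂ t u → Counted3 r₁ r₂ r₃ m n k u v → Counted3 r₁ r₂ r₃ m (n + 1) k t v
  | step₃ {t u v : α} {m n k : ℕ} :
      r₃ t u → Counted3 r₁ r₂ r₃ m n k u v → Counted3 r₁ r₂ r₃ m n (k + 1) t v

/-! ### Terms of the distant Bang calculus λ! (de Bruijn representation) -/

/-- Terms of λ!: variables, application, abstraction, bang, dereliction and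
explicit substitution (`sub t u` is `t[x←u]`, the binder being in `t`). -/
inductive T : Type
  | var : ℕ → T
  | app : T → T → T
  | lam : T → T
  | bang : T → T
  | der : T → T
  | sub : T → T → T

namespace T

/-- Lift (shift by one) the free de Bruijn variables `≥ k`. -/
def lift (k : ℕ) : T → T
  | var n => if n < k then var n else var (n + 1)
  | app a b => app (lift k a) (lift k b)
  | lam a => lam (lift (k + 1) a)
  | bang a => bang (lift k a)
  | der a => der (lift k a)
  | sub a b => sub (lift (k + 1) a) (lift k b)

/-- Lift all free variables by `m` (crossing `m` binders). -/
def liftN (m : ℕ) (t : T) : T := (lift 0)^[m] t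

/-- Lift all free variables except the first one by `m`
(used to push a term with one distinguished bound variable under `m` extra binders). -/
def liftUnder (m : ℕ) (t : T) : T := (lift 1)^[m] t

/-- Capture-avoiding substitution `t{k := u}` of `u` for de Bruijn variable `k`. -/
def subst : T → ℕ → T → T
  | var n, k, u => if n < k then var n else if n = k then liftN k u else var (n - 1)
  | app a b, k, u => app (subst a k u) (subst b k u)
  | lam a, k, u => lam (subst a (k + 1) u)
  | bang a, k, u => bang (subst a k u)
  | der a, k, u => der (subst a k u)
  | sub a b, k, u => sub (subst a (k + 1) u) (subst b k u)

/-- The number of constructors (full size) of a term: it counts all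
applications, abstractions, explicit substitutions, `!` and `der` occurrences. -/
def size : T → ℕ
  | var _ => 0
  | app a b => 1 + size a + size b
  | lam a => 1 + size a
  | bang a => 1 + size a
  | der a => 1 + size a
  | sub a b => 1 + size a + size b

end T

/-- Plugging a term into a list context `⟨·⟩[x₁←t₁]…[xₙ←tₙ]`
(represented as the list `[t₁, …, tₙ]`). -/
def fillL : T → List T → T
  | s, [] => s
  | s, t :: L => fillL (T.sub s t) L

/-! ### Rewrite rules of λ! -/

/-- The names of the three rewrite rules of λ!: `dB`, `s!` and `d!`. -/
inductive Rule : Type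
  | dB : Rule
  | sBang : Rule
  | dBang : Rule

/-- Root steps of the three rewrite rules of λ! (at a distance, capture-free):
`(dB)  L⟨λx.t⟩ u ↦ L⟨t[x←u]⟩`, `(s!)  t[x←L⟨!u⟩] ↦ L⟨t{x:=u}⟩`,
`(d!)  der(L⟨!t⟩) ↦ L⟨t⟩`. -/
inductive Root : Rule → T → T → Prop
  | dB (t u : T) (L : List T) :
      Root Rule.dB (T.app (fillL (T.lam t) L) u)
        (fillL (T.sub t (T.liftN L.length u)) L)
  | sBang (t u : T) (L : List T) :
      Root Rule.sBang (T.sub t (fillL (T.bang u) L))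
        (fillL (T.subst (T.liftUnder L.length t) 0 u) L)
  | dBang (t : T) (L : List T) :
      Root Rule.dBang (T.der (fillL (T.bang t) L)) (fillL t L)

/-! ### Contexts of λ! -/

/-- (Full) contexts of λ!: terms with exactly one hole, the hole may occur anywhere. -/
inductive Ctx : Type
  | hole : Ctx
  | appL : Ctx → T → Ctx
  | appR : T → Ctx → Ctx
  | lam : Ctx → Ctx
  | bang : Ctx → Ctx
  | der : Ctx → Ctx
  | subL : Ctx → T → Ctx
  | subR : T → Ctx → Ctx

namespace Ctx

/-- Plugging a term in a context (possibly capturing its free variables). -/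
def fill : Ctx → T → T
  | hole, s => s
  | appL C t, s => T.app (fill C s) t
  | appR t C, s => T.app t (fill C s)
  | lam C, s => T.lam (fill C s)
  | bang C, s => T.bang (fill C s)
  | der C, s => T.der (fill C s)
  | subL C t, s => T.sub (fill C s) t
  | subR t C, s => T.sub t (fill C s)

/-- Surface contexts: the hole does not occur under a `!`. -/
def Surface : Ctx → Prop
  | hole => True
  | appL C _ => Surface C
  | appR _ C => Surface C
  | lam C => Surface C
  | bang _ => False
  | der C => Surface C
  | subL C _ => Surface C
  | subR _ C => Surface C

/-- Internal contexts: the full contexts that are not surface (the hole occurs under a `!`). -/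
def Internal (C : Ctx) : Prop := ¬ Surface C

end Ctx

/-! ### Reductions of λ! -/

/-- `StepAt R C t u`: `t` rewrites to `u` by firing a redex of rule `R` under context `C`. -/
def StepAt (R : Rule) (C : Ctx) (t u : T) : Prop :=
  ∃ a b, Root R a b ∧ t = C.fill a ∧ u = C.fill b

/-- One step of rule `R` under some full context (`→F,R`). -/
def FStepR (R : Rule) (t u : T) : Prop := ∃ C : Ctx, StepAt R C t u

/-- One step of rule `R` under some surface context (`→S,R`). -/
def SStepR (R : Rule) (t u : T) : Prop := ∃ C : Ctx, C.Surface ∧ StepAt R C t u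

/-- One step of rule `R` under some internal context (`→I,R`). -/
def IStepR (R : Rule) (t u : T) : Prop := ∃ C : Ctx, C.Internal ∧ StepAt R C t u

/-- Full reduction `→F` of λ!. -/
def FStep (t u : T) : Prop := ∃ R, FStepR R t u

/-- Surface reduction `→S` of λ!. -/
def SStep (t u : T) : Prop := ∃ R, SStepR R t u

/-- Internal reduction `→I` of λ!. -/
def IStep (t u : T) : Prop := ∃ R, IStepR R t u

/-- Diligent administrative surface reduction `→Sai`: `d!`-surface steps, together with
`dB`- and `s!`-surface steps whose source is a `→S,d!`-normal form. -/
def SaiStep (t u : T) : Prop :=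
  SStepR Rule.dBang t u ∨
    ((SStepR Rule.dB t u ∨ SStepR Rule.sBang t u) ∧ IsNF (SStepR Rule.dBang) t)

/-- Diligent administrative full reduction `→Fai`: `d!`-full steps, together with
`dB`- and `s!`-full steps whose source is a `→F,d!`-normal form. -/
def FaiStep (t u : T) : Prop :=
  FStepR Rule.dBang t u ∨
    ((FStepR Rule.dB t u ∨ FStepR Rule.sBang t u) ∧ IsNF (FStepR Rule.dBang) t)

/-! ### Terms of the CBN / CBV calculi (shared syntax, de Bruijn) -/

/-- Terms of the CBN/CBV calculi: variables, application, abstraction and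
explicit substitution (no `!`, no `der`). -/
inductive LT : Type
  | var : ℕ → LT
  | app : LT → LT → LT
  | lam : LT → LT
  | sub : LT → LT → LT

namespace LT

/-- Lift (shift by one) the free de Bruijn variables `≥ k`. -/
def lift (k : ℕ) : LT → LT
  | var n => if n < k then var n else var (n + 1)
  | app a b => app (lift k a) (lift k b)
  | lam a => lam (lift (k + 1) a)
  | sub a b => sub (lift (k + 1) a) (lift k b)

/-- Lift all free variables by `m`. -/
def liftN (m : ℕ) (t : LT) : LT := (lift 0)^[m] t

/-- Lift all free variables except the first one by `m`. -/
def liftUnder (m : ℕ) (t : LT) : LT := (lift 1)^[m] t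

/-- Capture-avoiding substitution `t{k := u}`. -/
def subst : LT → ℕ → LT → LT
  | var n, k, u => if n < k then var n else if n = k then liftN k u else var (n - 1)
  | app a b, k, u => app (subst a k u) (subst b k u)
  | lam a, k, u => lam (subst a (k + 1) u)
  | sub a b, k, u => sub (subst a (k + 1) u) (subst b k u)

/-- Values: variables and abstractions. -/
def IsValue : LT → Prop
  | var _ => True
  | lam _ => True
  | _ => False

end LT

/-- Plugging a CBN/CBV term into a list context. -/
def fillLN : LT → List LT → LT
  | s, [] => s
  | s, t :: L => fillLN (LT.sub s t) L

/-- The names of the CBN rewrite rules: `dB` and `s`. -/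
inductive NRule : Type
  | dB : NRule
  | s : NRule

/-- Root steps of the CBN rules:
`(dB) L⟨λx.t⟩ u ↦ L⟨t[x←u]⟩` and `(s) t[x←u] ↦ t{x:=u}`. -/
inductive NRoot : NRule → LT → LT → Prop
  | dB (t u : LT) (L : List LT) :
      NRoot NRule.dB (LT.app (fillLN (LT.lam t) L) u)
        (fillLN (LT.sub t (LT.liftN L.length u)) L)
  | s (t u : LT) : NRoot NRule.s (LT.sub t u) (LT.subst t 0 u)

/-- The names of the CBV rewrite rules: `dB` and `sV`. -/
inductive VRule : Type
  | dB : VRule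
  | sV : VRule

/-- Root steps of the CBV rules:
`(dB) L⟨λx.t⟩ u ↦ L⟨t[x←u]⟩` and `(sV) t[x←L⟨v⟩] ↦ L⟨t{x:=v}⟩` for `v` a value. -/
inductive VRoot : VRule → LT → LT → Prop
  | dB (t u : LT) (L : List LT) :
      VRoot VRule.dB (LT.app (fillLN (LT.lam t) L) u)
        (fillLN (LT.sub t (LT.liftN L.length u)) L)
  | sV (t v : LT) (L : List LT) : v.IsValue →
      VRoot VRule.sV (LT.sub t (fillLN v L))
        (fillLN (LT.subst (LT.liftUnder L.length t) 0 v) L)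

/-- (Full) contexts of the CBN/CBV calculi. -/
inductive LCtx : Type
  | hole : LCtx
  | appL : LCtx → LT → LCtx
  | appR : LT → LCtx → LCtx
  | lam : LCtx → LCtx
  | subL : LCtx → LT → LCtx
  | subR : LT → LCtx → LCtx

namespace LCtx

/-- Plugging a term in a CBN/CBV context. -/
def fill : LCtx → LT → LT
  | hole, s => s
  | appL C t, s => LT.app (fill C s) t
  | appR t C, s => LT.app t (fill C s)
  | lam C, s => LT.lam (fill C s)
  | subL C t, s => LT.sub (fill C s) t
  | subR t C, s => LT.sub t (fill C s)

/-- CBN surface contexts: the hole never occurs in the argument of an application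
or of an explicit substitution. -/
def NSurface : LCtx → Prop
  | hole => True
  | appL C _ => NSurface C
  | appR _ _ => False
  | lam C => NSurface C
  | subL C _ => NSurface C
  | subR _ _ => False

/-- CBV surface contexts: the hole never occurs under an abstraction. -/
def VSurface : LCtx → Prop
  | hole => True
  | appL C _ => VSurface C
  | appR _ C => VSurface C
  | lam _ => False
  | subL C _ => VSurface C
  | subR _ C => VSurface C

end LCtx

/-- `NStepAt R C t u`: the CBN step firing rule `R` under context `C`. -/
def NStepAt (R : NRule) (C : LCtx) (t u : LT) : Prop :=
  ∃ a b, NRoot R a b ∧ t = C.fill a ∧ u = C.fill b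

/-- `VStepAt R C t u`: the CBV step firing rule `R` under context `C`. -/
def VStepAt (R : VRule) (C : LCtx) (t u : LT) : Prop :=
  ∃ a b, VRoot R a b ∧ t = C.fill a ∧ u = C.fill b

/-- One CBN step of rule `R` under some full context. -/
def NFStepR (R : NRule) (t u : LT) : Prop := ∃ C : LCtx, NStepAt R C t u

/-- One CBN step of rule `R` under some surface context. -/
def NSStepR (R : NRule) (t u : LT) : Prop := ∃ C : LCtx, C.NSurface ∧ NStepAt R C t u

/-- One CBN step of rule `R` under some internal context. -/
def NIStepR (R : NRule) (t u : LT) : Prop := ∃ C : LCtx, ¬ C.NSurface ∧ NStepAt R C t u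

/-- CBN full reduction `→ⁿF`. -/
def NFStep (t u : LT) : Prop := ∃ R, NFStepR R t u

/-- CBN surface reduction `→ⁿS`. -/
def NSStep (t u : LT) : Prop := ∃ R, NSStepR R t u

/-- CBN internal reduction `→ⁿI`. -/
def NIStep (t u : LT) : Prop := ∃ R, NIStepR R t u

/-- One CBV step of rule `R` under some full context. -/
def VFStepR (R : VRule) (t u : LT) : Prop := ∃ C : LCtx, VStepAt R C t u

/-- One CBV step of rule `R` under some surface context. -/
def VSStepR (R : VRule) (t u : LT) : Prop := ∃ C : LCtx, C.VSurface ∧ VStepAt R C t u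

/-- One CBV step of rule `R` under some internal context. -/
def VIStepR (R : VRule) (t u : LT) : Prop := ∃ C : LCtx, ¬ C.VSurface ∧ VStepAt R C t u

/-- CBV full reduction `→ᵛF`. -/
def VFStep (t u : LT) : Prop := ∃ R, VFStepR R t u

/-- CBV surface reduction `→ᵛS`. -/
def VSStep (t u : LT) : Prop := ∃ R, VSStepR R t u

/-- CBV internal reduction `→ᵛI`. -/
def VIStep (t u : LT) : Prop := ∃ R, VIStepR R t u

/-! ### The CBN embedding into λ! -/

/-- The CBN embedding `(·)ⁿ : xⁿ = x, (λx.t)ⁿ = λx.tⁿ, (t u)ⁿ = tⁿ !(uⁿ),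
(t[x←u])ⁿ = tⁿ[x←!(uⁿ)]`. -/
def embN : LT → T
  | LT.var n => T.var n
  | LT.app t u => T.app (embN t) (T.bang (embN u))
  | LT.lam t => T.lam (embN t)
  | LT.sub t u => T.sub (embN t) (T.bang (embN u))

/-- The CBN embedding extended to contexts, with `⟨·⟩ⁿ = ⟨·⟩`. -/
def embNC : LCtx → Ctx
  | LCtx.hole => Ctx.hole
  | LCtx.appL C t => Ctx.appL (embNC C) (T.bang (embN t))
  | LCtx.appR t C => Ctx.appR (embN t) (Ctx.bang (embNC C))
  | LCtx.lam C => Ctx.lam (embNC C)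
  | LCtx.subL C t => Ctx.subL (embNC C) (T.bang (embN t))
  | LCtx.subR t C => Ctx.subR (embN t) (Ctx.bang (embNC C))

/-- The CBN embedding on rule names: `dBⁿ = dB`, `sⁿ = s!`. -/
def embNRule : NRule → Rule
  | NRule.dB => Rule.dB
  | NRule.s => Rule.sBang

/-! ### The CBV embedding into λ! -/

/-- If `t = L⟨!s⟩` for a list context `L`, return `some L⟨s⟩`, otherwise `none`. -/
def strip? : T → Option T
  | T.bang s => some s
  | T.sub a b => (strip? a).map (fun a' => T.sub a' b)
  | _ => none

/-- The (new) CBV embedding `(·)ᵛ : xᵛ = !x, (λx.t)ᵛ = !λx.!(tᵛ),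
(t u)ᵛ = der(L⟨s⟩ uᵛ)` if `tᵛ = L⟨!s⟩` and `der(der(tᵛ) uᵛ)` otherwise,
`(t[x←u])ᵛ = tᵛ[x←uᵛ]`. -/
def embV : LT → T
  | LT.var n => T.bang (T.var n)
  | LT.lam t => T.bang (T.lam (T.bang (embV t)))
  | LT.app t u =>
      match strip? (embV t) with
      | some s => T.der (T.app s (embV u))
      | none => T.der (T.app (T.der (embV t)) (embV u))
  | LT.sub t u => T.sub (embV t) (embV u)

/-- The CBV embedding on rule names: `dBᵛ = dB`, `sVᵛ = s!`. -/
def embVRule : VRule → Rule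
  | VRule.dB => Rule.dB
  | VRule.sV => Rule.sBang

/-! ### Parallel renamings and substitutions -/

namespace T

/-- Push a renaming under a binder. -/
def upRen (ρ : ℕ → ℕ) : ℕ → ℕ
  | 0 => 0
  | i + 1 => ρ i + 1

/-- Parallel renaming. -/
def ren : (ℕ → ℕ) → T → T
  | ρ, var n => var (ρ n)
  | ρ, app a b => app (ren ρ a) (ren ρ b)
  | ρ, lam a => lam (ren (upRen ρ) a)
  | ρ, bang a => bang (ren ρ a)
  | ρ, der a => der (ren ρ a)
  | ρ, sub a b => sub (ren (upRen ρ) a) (ren ρ b)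

/-- Push a parallel substitution under a binder. -/
def up (σ : ℕ → T) : ℕ → T
  | 0 => var 0
  | i + 1 => ren Nat.succ (σ i)

/-- Parallel substitution. -/
def inst : (ℕ → T) → T → T
  | σ, var n => σ n
  | σ, app a b => app (inst σ a) (inst σ b)
  | σ, lam a => lam (inst (up σ) a)
  | σ, bang a => bang (inst σ a)
  | σ, der a => der (inst σ a)
  | σ, sub a b => sub (inst (up σ) a) (inst σ b)

/-- The substitution replacing variable `0` by `u` and decrementing the others. -/
def single (u : T) : ℕ → T
  | 0 => u
  | i + 1 => var i

theorem up_var (ρ : ℕ → ℕ) : up (fun i => var (ρ i)) = fun i => var (upRen ρ i) := by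
  funext i; cases i <;> rfl

theorem ren_eq_inst (ρ : ℕ → ℕ) (t : T) : ren ρ t = inst (fun i => var (ρ i)) t := by
  induction t generalizing ρ <;> simp_all [ren, inst, up_var]

theorem up_comp_upRen (σ : ℕ → T) (ρ : ℕ → ℕ) :
    (fun i => up σ (upRen ρ i)) = up (fun i => σ (ρ i)) := by
  funext i; cases i <;> rfl

theorem inst_ren (σ : ℕ → T) (ρ : ℕ → ℕ) (t : T) :
    inst σ (ren ρ t) = inst (fun i => σ (ρ i)) t := by
  induction t generalizing ρ σ <;> simp_all [ren, inst, up_comp_upRen]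

theorem ren_ren (ρ ρ' : ℕ → ℕ) (t : T) : ren ρ (ren ρ' t) = ren (fun i => ρ (ρ' i)) t := by
  rw [ren_eq_inst, inst_ren, ren_eq_inst]

theorem ren_upRen_comp_up (ρ : ℕ → ℕ) (σ : ℕ → T) :
    (fun i => ren (upRen ρ) (up σ i)) = up (fun i => ren ρ (σ i)) := by
  funext i
  cases i
  · rfl
  · simp [up, ren_ren, upRen]

theorem ren_inst (ρ : ℕ → ℕ) (σ : ℕ → T) (t : T) :
    ren ρ (inst σ t) = inst (fun i => ren ρ (σ i)) t := by
  induction t generalizing ρ σ <;> simp_all [ren, inst, ren_upRen_comp_up]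

theorem inst_up_comp_up (τ σ : ℕ → T) :
    (fun i => inst (up τ) (up σ i)) = up (fun i => inst τ (σ i)) := by
  funext i
  cases i
  · rfl
  · simp [up, inst_ren, ren_inst]

theorem inst_inst (τ σ : ℕ → T) (t : T) :
    inst τ (inst σ t) = inst (fun i => inst τ (σ i)) t := by
  induction t generalizing τ σ <;> simp_all [inst, inst_up_comp_up]

theorem ren_id (t : T) : ren (fun i => i) t = t := by
  have h : upRen (fun i => i) = fun i => i := by funext i; cases i <;> rfl
  induction t <;> simp_all [ren]

theorem lift_eq_ren (k : ℕ) (t : T) :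
    lift k t = ren (fun n => if n < k then n else n + 1) t := by
  have h (k : ℕ) : upRen (fun n => if n < k then n else n + 1) =
      fun n => if n < k + 1 then n else n + 1 := by
    funext i
    cases i
    · simp [upRen]
    · simp only [upRen]; split_ifs <;> omega
  induction t generalizing k <;> simp_all [lift, ren]
  split_ifs <;> rfl

theorem liftN_eq_ren (m : ℕ) (t : T) : liftN m t = ren (fun i => i + m) t := by
  induction m with
  | zero => exact (ren_id t).symm
  | succ m ih =>
    rw [liftN, Function.iterate_succ_apply', ← liftN, ih, lift_eq_ren, ren_ren]
    rfl

theorem liftUnder_eq_ren (m : ℕ) (t : T) :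
    liftUnder m t = ren (upRen fun i => i + m) t := by
  induction m with
  | zero =>
    have h : (upRen fun i => i + 0) = fun i => i := by funext i; cases i <;> rfl
    rw [h, ren_id]; rfl
  | succ m ih =>
    rw [liftUnder, Function.iterate_succ_apply', ← liftUnder, ih, lift_eq_ren, ren_ren]
    congr 1
    funext i
    cases i <;> simp [upRen]
    omega

theorem up_iterate_add (n : ℕ) (σ : ℕ → T) (i : ℕ) :
    (up^[n] σ) (i + n) = ren (fun j => j + n) (σ i) := by
  induction n with
  | zero => exact (ren_id _).symm
  | succ n ih =>
    rw [Function.iterate_succ_apply', ← Nat.add_assoc, up, ih, ren_ren]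
    rfl

theorem up_iterate_of_lt {n i : ℕ} (σ : ℕ → T) (h : i < n) : (up^[n] σ) i = var i := by
  induction n generalizing i with
  | zero => omega
  | succ n ih =>
    rw [Function.iterate_succ_apply']
    cases i with
    | zero => rfl
    | succ i => rw [up, ih (by omega)]; rfl

theorem subst_eq_inst (t : T) (k : ℕ) (u : T) :
    subst t k u = inst (up^[k] (single u)) t := by
  induction t generalizing k with
  | var n =>
    simp only [subst, inst]
    split_ifs with h h'
    · rw [up_iterate_of_lt _ h]
    · subst h'
      simpa [single, liftN_eq_ren] using (up_iterate_add n (single u) 0).symm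
    · obtain ⟨i, rfl⟩ : ∃ i, n = i + 1 + k := ⟨n - k - 1, by omega⟩
      rw [up_iterate_add]
      simp only [single, ren]
      congr 1
      omega
  | _ => simp_all [subst, inst, Function.iterate_succ_apply']

theorem subst_zero_eq_inst (t u : T) : subst t 0 u = inst (single u) t :=
  subst_eq_inst t 0 u

theorem inst_liftN (n : ℕ) (σ : ℕ → T) (t : T) :
    inst (up^[n] σ) (liftN n t) = liftN n (inst σ t) := by
  simp only [liftN_eq_ren, inst_ren, ren_inst, up_iterate_add]

theorem inst_subst_liftUnder (n : ℕ) (σ : ℕ → T) (t u : T) :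
    inst (up^[n] σ) (subst (liftUnder n t) 0 u) =
      subst (liftUnder n (inst (up σ) t)) 0 (inst (up^[n] σ) u) := by
  simp only [subst_zero_eq_inst, liftUnder_eq_ren, inst_ren, inst_inst]
  congr 1
  funext i
  cases i with
  | zero => rfl
  | succ i =>
    simp only [upRen, single, inst, up, inst_ren, up_iterate_add]
    exact ren_eq_inst _ _

/-- Parallel substitution in the list representing a list context. -/
def instL (σ : ℕ → T) : List T → List T
  | [] => []
  | t :: L => inst (up^[L.length] σ) t :: instL σ L

@[simp]
theorem length_instL (σ : ℕ → T) (L : List T) : (instL σ L).length = L.length := by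
  induction L <;> simp_all [instL]

theorem inst_fillL (σ : ℕ → T) (s : T) (L : List T) :
    inst σ (fillL s L) = fillL (inst (up^[L.length] σ) s) (instL σ L) := by
  induction L generalizing s with
  | nil => rfl
  | cons t L ih => simp [fillL, ih, inst, instL, Function.iterate_succ_apply']

end T

open Relation T

/-! ### Closure properties of the reductions -/

theorem Root.inst {r : Rule} {a b : T} (h : Root r a b) (σ : ℕ → T) :
    Root r (a.inst σ) (b.inst σ) := by
  cases h with
  | dB t u L =>
    simp only [T.inst, inst_fillL, inst_liftN]
    simpa using Root.dB (t.inst (up (up^[L.length] σ))) (u.inst σ) (instL σ L)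
  | sBang t u L =>
    simp only [T.inst, inst_fillL, inst_subst_liftUnder]
    simpa using Root.sBang (t.inst (up σ)) (u.inst (up^[L.length] σ)) (instL σ L)
  | dBang t L =>
    simp only [T.inst, inst_fillL]
    exact Root.dBang _ _

theorem SStep.root {r : Rule} {a b : T} (h : Root r a b) : SStep a b :=
  ⟨r, .hole, trivial, a, b, h, rfl, rfl⟩

theorem SStep.appL {a b : T} (c : T) : SStep a b → SStep (app a c) (app b c) := by
  rintro ⟨r, C, hC, x, y, h, rfl, rfl⟩
  exact ⟨r, .appL C c, hC, x, y, h, rfl, rfl⟩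

theorem SStep.appR {a b : T} (c : T) : SStep a b → SStep (app c a) (app c b) := by
  rintro ⟨r, C, hC, x, y, h, rfl, rfl⟩
  exact ⟨r, .appR c C, hC, x, y, h, rfl, rfl⟩

theorem SStep.lam {a b : T} : SStep a b → SStep (lam a) (lam b) := by
  rintro ⟨r, C, hC, x, y, h, rfl, rfl⟩
  exact ⟨r, .lam C, hC, x, y, h, rfl, rfl⟩

theorem SStep.der {a b : T} : SStep a b → SStep (der a) (der b) := by
  rintro ⟨r, C, hC, x, y, h, rfl, rfl⟩
  exact ⟨r, .der C, hC, x, y, h, rfl, rfl⟩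

theorem SStep.subL {a b : T} (c : T) : SStep a b → SStep (sub a c) (sub b c) := by
  rintro ⟨r, C, hC, x, y, h, rfl, rfl⟩
  exact ⟨r, .subL C c, hC, x, y, h, rfl, rfl⟩

theorem SStep.subR {a b : T} (c : T) : SStep a b → SStep (sub c a) (sub c b) := by
  rintro ⟨r, C, hC, x, y, h, rfl, rfl⟩
  exact ⟨r, .subR c C, hC, x, y, h, rfl, rfl⟩

theorem IStep.appL {a b : T} (c : T) : IStep a b → IStep (app a c) (app b c) := by
  rintro ⟨r, C, hC, x, y, h, rfl, rfl⟩
  exact ⟨r, .appL C c, hC, x, y, h, rfl, rfl⟩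

theorem IStep.appR {a b : T} (c : T) : IStep a b → IStep (app c a) (app c b) := by
  rintro ⟨r, C, hC, x, y, h, rfl, rfl⟩
  exact ⟨r, .appR c C, hC, x, y, h, rfl, rfl⟩

theorem IStep.lam {a b : T} : IStep a b → IStep (lam a) (lam b) := by
  rintro ⟨r, C, hC, x, y, h, rfl, rfl⟩
  exact ⟨r, .lam C, hC, x, y, h, rfl, rfl⟩

theorem IStep.der {a b : T} : IStep a b → IStep (der a) (der b) := by
  rintro ⟨r, C, hC, x, y, h, rfl, rfl⟩
  exact ⟨r, .der C, hC, x, y, h, rfl, rfl⟩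

theorem IStep.subL {a b : T} (c : T) : IStep a b → IStep (sub a c) (sub b c) := by
  rintro ⟨r, C, hC, x, y, h, rfl, rfl⟩
  exact ⟨r, .subL C c, hC, x, y, h, rfl, rfl⟩

theorem IStep.subR {a b : T} (c : T) : IStep a b → IStep (sub c a) (sub c b) := by
  rintro ⟨r, C, hC, x, y, h, rfl, rfl⟩
  exact ⟨r, .subR c C, hC, x, y, h, rfl, rfl⟩

theorem IStep.bang {a b : T} : FStep a b → IStep (bang a) (bang b) := by
  rintro ⟨r, C, x, y, h, rfl, rfl⟩
  exact ⟨r, .bang C, fun hC => hC, x, y, h, rfl, rfl⟩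

theorem SStep.fStep {a b : T} : SStep a b → FStep a b :=
  fun ⟨r, C, _, h⟩ => ⟨r, C, h⟩

theorem IStep.fStep {a b : T} : IStep a b → FStep a b :=
  fun ⟨r, C, _, h⟩ => ⟨r, C, h⟩

theorem reflTransGen_fStep_trans {a b c : T} (hs : ReflTransGen SStep a b)
    (hi : ReflTransGen IStep b c) : ReflTransGen FStep a c :=
  (hs.lift id fun _ _ => SStep.fStep).trans (hi.lift id fun _ _ => IStep.fStep)

theorem SStep.inst {a b : T} (h : SStep a b) (σ : ℕ → T) :
    SStep (a.inst σ) (b.inst σ) := by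
  obtain ⟨r, C, hC, x, y, h, rfl, rfl⟩ := h
  induction C generalizing σ with
  | hole => exact .root (h.inst σ)
  | appL C c ih => exact (ih σ hC).appL _
  | appR c C ih => exact (ih σ hC).appR _
  | lam C ih => exact (ih (up σ) hC).lam
  | bang C ih => exact hC.elim
  | der C ih => exact (ih σ hC).der
  | subL C c ih => exact (ih (up σ) hC).subL _
  | subR c C ih => exact (ih σ hC).subR _

/-! ### Layered internal reduction -/

/-- `a` and `b` have the same constructors outside `!`, and under each outermost `!`
the term of `a` reduces to that of `b` by surface steps followed, recursively,
by layered internal reduction. -/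
inductive LayeredI : T → T → Prop
  | var (n : ℕ) : LayeredI (var n) (var n)
  | app {a a' b b' : T} : LayeredI a a' → LayeredI b b' → LayeredI (app a b) (app a' b')
  | lam {a a' : T} : LayeredI a a' → LayeredI (lam a) (lam a')
  | bang {a b a' : T} : ReflTransGen SStep a b → LayeredI b a' → LayeredI (bang a) (bang a')
  | der {a a' : T} : LayeredI a a' → LayeredI (der a) (der a')
  | sub {a a' b b' : T} : LayeredI a a' → LayeredI b b' → LayeredI (sub a b) (sub a' b')

/-- Surface reduction followed by layered internal reduction. -/
def Layered (t u : T) : Prop := ∃ s, ReflTransGen SStep t s ∧ LayeredI s u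

theorem LayeredI.refl (t : T) : LayeredI t t := by
  induction t with
  | var n => exact .var n
  | app _ _ h₁ h₂ => exact .app h₁ h₂
  | lam _ h => exact .lam h
  | bang _ h => exact .bang .refl h
  | der _ h => exact .der h
  | sub _ _ h₁ h₂ => exact .sub h₁ h₂

theorem LayeredI.layered {t u : T} (h : LayeredI t u) : Layered t u := ⟨t, .refl, h⟩

theorem Layered.head {t s u : T} (h : ReflTransGen SStep t s) : Layered s u → Layered t u :=
  fun ⟨v, hs, hv⟩ => ⟨v, h.trans hs, hv⟩

namespace Layered

theorem app {a a' b b' : T} : Layered a a' → Layered b b' →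
    Layered (T.app a b) (T.app a' b') := by
  rintro ⟨x, hx, hx'⟩ ⟨y, hy, hy'⟩
  exact ⟨_, (hx.lift (T.app · b) fun _ _ h => h.appL b).trans
    (hy.lift (T.app x) fun _ _ h => h.appR x), .app hx' hy'⟩

theorem sub {a a' b b' : T} : Layered a a' → Layered b b' →
    Layered (T.sub a b) (T.sub a' b') := by
  rintro ⟨x, hx, hx'⟩ ⟨y, hy, hy'⟩
  exact ⟨_, (hx.lift (T.sub · b) fun _ _ h => h.subL b).trans
    (hy.lift (T.sub x) fun _ _ h => h.subR x), .sub hx' hy'⟩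

theorem lam {a a' : T} : Layered a a' → Layered (T.lam a) (T.lam a') :=
  fun ⟨_, hx, hx'⟩ => ⟨_, hx.lift T.lam fun _ _ h => h.lam, .lam hx'⟩

theorem der {a a' : T} : Layered a a' → Layered (T.der a) (T.der a') :=
  fun ⟨_, hx, hx'⟩ => ⟨_, hx.lift T.der fun _ _ h => h.der, .der hx'⟩

theorem bang {a a' : T} : Layered a a' → LayeredI (T.bang a) (T.bang a') :=
  fun ⟨_, hx, hx'⟩ => .bang hx hx'

theorem fillL {a a' : T} {L L' : List T} (h : Layered a a')
    (hL : List.Forall₂ LayeredI L L') : Layered (fillL a L) (fillL a' L') := by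
  induction hL generalizing a a' with
  | nil => exact h
  | cons hb _ ih => exact ih (h.sub hb.layered)

end Layered

theorem reflTransGen_sStep_inst {a b : T} (h : ReflTransGen SStep a b) (σ : ℕ → T) :
    ReflTransGen SStep (a.inst σ) (b.inst σ) :=
  h.lift (T.inst σ) fun _ _ h => h.inst σ

theorem reflTransGen_sStep_ren {a b : T} (h : ReflTransGen SStep a b) (ρ : ℕ → ℕ) :
    ReflTransGen SStep (a.ren ρ) (b.ren ρ) := by
  simpa only [ren_eq_inst] using reflTransGen_sStep_inst h _

theorem LayeredI.ren {t u : T} (h : LayeredI t u) (ρ : ℕ → ℕ) :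
    LayeredI (t.ren ρ) (u.ren ρ) := by
  induction h generalizing ρ with
  | var n => exact .var _
  | app _ _ h₁ h₂ => exact .app (h₁ ρ) (h₂ ρ)
  | lam _ h => exact .lam (h _)
  | bang hs _ h => exact .bang (reflTransGen_sStep_ren hs ρ) (h ρ)
  | der _ h => exact .der (h ρ)
  | sub _ _ h₁ h₂ => exact .sub (h₁ _) (h₂ ρ)

theorem Layered.ren {t u : T} (h : Layered t u) (ρ : ℕ → ℕ) :
    Layered (t.ren ρ) (u.ren ρ) :=
  let ⟨_, hs, hi⟩ := h
  ⟨_, reflTransGen_sStep_ren hs ρ, hi.ren ρ⟩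

theorem Layered.up {σ τ : ℕ → T} (h : ∀ i, Layered (σ i) (τ i)) (i : ℕ) :
    Layered (T.up σ i) (T.up τ i) := by
  cases i with
  | zero => exact (LayeredI.var 0).layered
  | succ i => exact (h i).ren _

theorem LayeredI.inst {t u : T} (h : LayeredI t u) {σ τ : ℕ → T}
    (hσ : ∀ i, Layered (σ i) (τ i)) : Layered (t.inst σ) (u.inst τ) := by
  induction h generalizing σ τ with
  | var n => exact hσ n
  | app _ _ h₁ h₂ => exact (h₁ hσ).app (h₂ hσ)
  | lam _ h => exact (h (Layered.up hσ)).lam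
  | bang hs _ h => exact ((h hσ).head (reflTransGen_sStep_inst hs σ)).bang.layered
  | der _ h => exact (h hσ).der
  | sub _ _ h₁ h₂ => exact (h₁ (Layered.up hσ)).sub (h₂ hσ)

theorem LayeredI.subst_zero {t t' u u' : T} (ht : LayeredI t t') (hu : Layered u u') :
    Layered (t.subst 0 u) (t'.subst 0 u') := by
  simp only [subst_zero_eq_inst]
  refine ht.inst fun i => ?_
  cases i with
  | zero => exact hu
  | succ i => exact (LayeredI.var i).layered

theorem LayeredI.exists_fillL {s x : T} {L : List T} (h : LayeredI s (fillL x L)) :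
    ∃ y K, s = fillL y K ∧ LayeredI y x ∧ List.Forall₂ LayeredI K L := by
  induction L generalizing x with
  | nil => exact ⟨s, [], rfl, h, .nil⟩
  | cons t L ih =>
    obtain ⟨y, K, rfl, hy, hK⟩ := ih h
    cases hy with
    | sub ha hb => exact ⟨_, _ :: K, rfl, ha, .cons hb hK⟩

theorem LayeredI.root {r : Rule} {s a b : T} (h : LayeredI s a) (hr : Root r a b) :
    Layered s b := by
  cases hr with
  | dB t u L =>
    cases h with
    | app h₁ h₂ =>
      obtain ⟨y, K, rfl, hy, hK⟩ := h₁.exists_fillL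
      cases hy with
      | lam hy =>
        refine .head (.single (.root (.dB _ _ K))) (.fillL (.sub hy.layered ?_) hK)
        rw [hK.length_eq, liftN_eq_ren, liftN_eq_ren]
        exact (h₂.ren _).layered
  | sBang t u L =>
    cases h with
    | sub h₁ h₂ =>
      obtain ⟨y, K, rfl, hy, hK⟩ := h₂.exists_fillL
      cases hy with
      | bang hs hy =>
        refine .head (.single (.root (.sBang _ _ K))) (.fillL ?_ hK)
        refine LayeredI.subst_zero ?_ ⟨_, hs, hy⟩
        rw [hK.length_eq, liftUnder_eq_ren, liftUnder_eq_ren]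
        exact h₁.ren _
  | dBang t L =>
    cases h with
    | der h =>
      obtain ⟨y, K, rfl, hy, hK⟩ := h.exists_fillL
      cases hy with
      | bang hs hy => exact .head (.single (.root (.dBang _ K))) (.fillL ⟨_, hs, hy⟩ hK)

theorem LayeredI.fStep {s t u : T} (h : LayeredI s t) (hf : FStep t u) : Layered s u := by
  obtain ⟨r, C, a, b, hr, rfl, rfl⟩ := hf
  induction C generalizing s with
  | hole => exact h.root hr
  | appL C c ih => cases h with | app h₁ h₂ => exact (ih h₁).app h₂.layered
  | appR c C ih => cases h with | app h₁ h₂ => exact h₁.layered.app (ih h₂)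
  | lam C ih => cases h with | lam h => exact (ih h).lam
  | bang C ih => cases h with | bang hs h => exact ((ih h).head hs).bang.layered
  | der C ih => cases h with | der h => exact (ih h).der
  | subL C c ih => cases h with | sub h₁ h₂ => exact (ih h₁).sub h₂.layered
  | subR c C ih => cases h with | sub h₁ h₂ => exact h₁.layered.sub (ih h₂)

theorem layered_of_reflTransGen_fStep {t u : T} (h : ReflTransGen FStep t u) :
    Layered t u := by
  induction h with
  | refl => exact (LayeredI.refl t).layered
  | tail _ hf ih =>
    obtain ⟨s, hs, hi⟩ := ih
    exact (hi.fStep hf).head hs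

theorem LayeredI.reflTransGen_iStep {t u : T} (h : LayeredI t u) :
    ReflTransGen IStep t u := by
  induction h with
  | var n => exact .refl
  | @app a a' b b' _ _ h₁ h₂ =>
    exact (h₁.lift (T.app · b) fun _ _ h => h.appL b).trans
      (h₂.lift (T.app a') fun _ _ h => h.appR a')
  | lam _ h => exact h.lift T.lam fun _ _ h => h.lam
  | bang hs _ h =>
    exact (reflTransGen_fStep_trans hs h).lift T.bang fun _ _ h => .bang h
  | der _ h => exact h.lift T.der fun _ _ h => h.der
  | @sub a a' b b' _ _ h₁ h₂ =>
    exact (h₁.lift (T.sub · b) fun _ _ h => h.subL b).trans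
      (h₂.lift (T.sub a') fun _ _ h => h.subR a')

/-- **Factorization for the distant Bang calculus λ!.**  Full reduction factorizes
through surface followed by internal reduction: `t →F* u` if and only if there exists
`s` with `t →S* s` and `s →I* u`. -/
theorem bang_factorization (t u : T) :
    Relation.ReflTransGen FStep t u ↔
      ∃ s, Relation.ReflTransGen SStep t s ∧ Relation.ReflTransGen IStep s u := by
  constructor
  · intro h
    obtain ⟨s, hs, hi⟩ := layered_of_reflTransGen_fStep h
    exact ⟨s, hs, hi.reflTransGen_iStep⟩
  · rintro ⟨s, hs, hi⟩
    exact reflTransGen_fStep_trans hs hi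

end BangPaper
end

section
/- (Factorization for CBN and CBV, projected from λ!.) In the CBN calculus, full reduction factorizes as →ⁿF* = →ⁿS* ∘ →ⁿI*, and in the CBV calculus, full reduction factorizes as →ᵛF* = →ᵛS* ∘ →ᵛI*: every full reduction sequence can be rearranged into a surface reduction sequence followed by an internal reduction sequence with the same start and end terms. -/
namespace BangPaper

namespace LT

/-! ### Lifting and substitution -/

theorem liftN_succ (k : ℕ) (u : LT) : liftN (k + 1) u = lift 0 (liftN k u) :=
  Function.iterate_succ_apply' _ _ _

theorem lift_lift (t : LT) {i j : ℕ} (h : i ≤ j) :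
    lift i (lift j t) = lift (j + 1) (lift i t) := by
  induction t generalizing i j with
  | var n =>
    simp only [lift]
    split_ifs <;> simp only [lift] <;> split_ifs <;> first | rfl | omega
  | app a b iha ihb => simp [lift, iha h, ihb h]
  | lam a ih => simp [lift, ih (Nat.succ_le_succ h)]
  | sub a b iha ihb => simp [lift, iha (Nat.succ_le_succ h), ihb h]

theorem lift_liftN (u : LT) (k i : ℕ) : lift (k + i) (liftN k u) = liftN k (lift i u) := by
  induction k with
  | zero => simp [liftN]
  | succ k ih =>
    rw [liftN_succ, liftN_succ, ← ih, lift_lift _ (Nat.zero_le _), Nat.add_right_comm]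

theorem lift_liftN_of_le (u : LT) {i k : ℕ} (h : i ≤ k) :
    lift i (liftN k u) = liftN (k + 1) u := by
  induction k generalizing i with
  | zero => obtain rfl := Nat.le_zero.mp h; rfl
  | succ k ih =>
    cases i with
    | zero => rw [← liftN_succ]
    | succ i =>
      rw [liftN_succ k, ← lift_lift _ (Nat.zero_le i), ih (Nat.le_of_succ_le_succ h),
        ← liftN_succ]

theorem subst_lift_self (t u : LT) (k : ℕ) : subst (lift k t) k u = t := by
  induction t generalizing k with
  | var n =>
    simp only [lift]
    split_ifs <;> simp only [subst] <;> split_ifs <;> first | rfl | omega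
  | app a b iha ihb => simp [lift, subst, iha, ihb]
  | lam a ih => simp [lift, subst, ih]
  | sub a b iha ihb => simp [lift, subst, iha, ihb]

theorem subst_lift (t w : LT) {i k : ℕ} (h : i ≤ k) :
    subst (lift i t) (k + 1) w = lift i (subst t k w) := by
  induction t generalizing i k with
  | var n =>
    simp only [lift, subst]
    split_ifs <;> simp only [lift, subst] <;> split_ifs <;>
      first
        | rfl
        | omega
        | exact (lift_liftN_of_le w h).symm
        | (congr 1; omega)
  | app a b iha ihb => simp [lift, subst, iha h, ihb h]
  | lam a ih => simp [lift, subst, ih (Nat.succ_le_succ h)]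
  | sub a b iha ihb => simp [lift, subst, iha (Nat.succ_le_succ h), ihb h]

theorem lift_subst (t v : LT) (j i : ℕ) :
    lift (j + i) (subst t j v) = subst (lift (j + i + 1) t) j (lift i v) := by
  induction t generalizing j with
  | var n =>
    simp only [lift, subst]
    split_ifs <;> simp only [lift, subst] <;> split_ifs <;>
      first
        | rfl
        | omega
        | exact lift_liftN v j i
        | (congr 1; omega)
  | app a b iha ihb => simp [lift, subst, iha, ihb]
  | lam a ih =>
    have := ih (j + 1)
    rw [Nat.add_right_comm j 1 i] at this
    simp [lift, subst, this]
  | sub a b iha ihb =>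
    have := iha (j + 1)
    rw [Nat.add_right_comm j 1 i] at this
    simp [lift, subst, this, ihb]

theorem subst_liftN (v w : LT) (j k : ℕ) :
    subst (liftN j v) (j + k) w = liftN j (subst v k w) := by
  induction j with
  | zero => simp [liftN]
  | succ j ih =>
    rw [liftN_succ, liftN_succ, ← ih, Nat.add_right_comm, subst_lift _ _ (Nat.zero_le _)]

theorem subst_subst (t v w : LT) (j k : ℕ) :
    subst (subst t j v) (j + k) w = subst (subst t (j + k + 1) w) j (subst v k w) := by
  induction t generalizing j with
  | var n =>
    rcases lt_trichotomy n j with h | rfl | h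
    · simp [subst, h, show n < j + k by omega, show n < j + k + 1 by omega]
    · simp [subst, show n < n + k + 1 by omega, subst_liftN]
    · rcases lt_trichotomy n (j + k + 1) with h' | rfl | h'
      · simp [subst, h', show ¬ n < j by omega, show n ≠ j by omega,
          show n - 1 < j + k by omega]
      · simp [subst, show ¬ j + k + 1 < j by omega, show j + k + 1 ≠ j by omega,
          ← lift_liftN_of_le w (Nat.le_add_right j k), subst_lift_self]
      · simp [subst, show ¬ n < j by omega, show n ≠ j by omega,
          show ¬ n - 1 < j + k by omega, show n - 1 ≠ j + k by omega,
          show ¬ n < j + k + 1 by omega, show n ≠ j + k + 1 by omega,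
          show ¬ n - 1 < j by omega, show n - 1 ≠ j by omega]
  | app a b iha ihb => simp [subst, iha, ihb]
  | lam a ih =>
    have := ih (j + 1)
    rw [Nat.add_right_comm j 1 k] at this
    simp [subst, this]
  | sub a b iha ihb =>
    have := iha (j + 1)
    rw [Nat.add_right_comm j 1 k] at this
    simp [subst, this, ihb]

theorem IsValue.lift {v : LT} (h : v.IsValue) (k : ℕ) : (lift k v).IsValue := by
  cases v with
  | var n => simp only [LT.lift]; split_ifs <;> trivial
  | lam a => trivial
  | app a b => exact h.elim
  | sub a b => exact h.elim

theorem IsValue.liftN {v : LT} (h : v.IsValue) (k : ℕ) : (liftN k v).IsValue := by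
  induction k with
  | zero => exact h
  | succ k ih => rw [liftN_succ]; exact ih.lift 0

theorem IsValue.subst {v w : LT} (h : v.IsValue) (hw : w.IsValue) (k : ℕ) :
    (subst v k w).IsValue := by
  cases v with
  | var n =>
    simp only [LT.subst]
    split_ifs
    · trivial
    · exact hw.liftN k
    · trivial
  | lam a => trivial
  | app a b => exact h.elim
  | sub a b => exact h.elim

end LT

open BangPaper.LT (lift liftN liftUnder subst)

/-! ### Distance rules, one explicit substitution at a time -/

/-- `DBeta a u r`: the application `a u` is a `dB`-redex with contractum `r`. -/
inductive DBeta : LT → LT → LT → Prop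
  | lam (t u : LT) : DBeta (LT.lam t) u (LT.sub t u)
  | sub {a u r : LT} (b : LT) : DBeta a (lift 0 u) r → DBeta (LT.sub a b) u (LT.sub r b)

/-- `SubVal t u r`: the explicit substitution `t[x←u]` is an `sV`-redex with contractum `r`. -/
inductive SubVal : LT → LT → LT → Prop
  | val (t : LT) {v : LT} : v.IsValue → SubVal t v (subst t 0 v)
  | sub {t a r : LT} (b : LT) : SubVal (lift 1 t) a r → SubVal t (LT.sub a b) (LT.sub r b)

theorem fillLN_concat (s : LT) (L : List LT) (b : LT) :
    fillLN s (L ++ [b]) = LT.sub (fillLN s L) b := by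
  induction L generalizing s with
  | nil => rfl
  | cons c L ih => exact ih _

theorem dBeta_fillLN (t u : LT) (L : List LT) :
    DBeta (fillLN (LT.lam t) L) u (fillLN (LT.sub t (liftN L.length u)) L) := by
  induction L using List.reverseRecOn generalizing u with
  | nil => exact .lam t u
  | append_singleton L b ih =>
    rw [fillLN_concat, fillLN_concat, List.length_append]
    exact .sub b (ih (lift 0 u))

theorem subVal_fillLN (t : LT) {v : LT} (hv : v.IsValue) (L : List LT) :
    SubVal t (fillLN v L) (fillLN (subst (liftUnder L.length t) 0 v) L) := by
  induction L using List.reverseRecOn generalizing t with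
  | nil => exact .val t hv
  | append_singleton L b ih =>
    rw [fillLN_concat, fillLN_concat, List.length_append]
    exact .sub b (ih (lift 1 t))

theorem DBeta.exists_fillLN {a u r : LT} (h : DBeta a u r) : ∃ t L,
    a = fillLN (LT.lam t) L ∧ r = fillLN (LT.sub t (liftN L.length u)) L := by
  induction h with
  | lam t u => exact ⟨t, [], rfl, rfl⟩
  | sub b _ ih =>
    obtain ⟨t, L, rfl, rfl⟩ := ih
    refine ⟨t, L ++ [b], (fillLN_concat _ _ _).symm, ?_⟩
    rw [fillLN_concat, List.length_append]
    rfl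

theorem SubVal.exists_fillLN {t u r : LT} (h : SubVal t u r) : ∃ v L, v.IsValue ∧
    u = fillLN v L ∧ r = fillLN (subst (liftUnder L.length t) 0 v) L := by
  induction h with
  | val t hv => exact ⟨_, [], hv, rfl, rfl⟩
  | sub b _ ih =>
    obtain ⟨v, L, hv, rfl, rfl⟩ := ih
    refine ⟨v, L ++ [b], hv, (fillLN_concat _ _ _).symm, ?_⟩
    rw [fillLN_concat, List.length_append]
    rfl

theorem DBeta.nRoot {a u r : LT} (h : DBeta a u r) : NRoot NRule.dB (LT.app a u) r := by
  obtain ⟨t, L, rfl, rfl⟩ := h.exists_fillLN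
  exact .dB t u L

theorem DBeta.vRoot {a u r : LT} (h : DBeta a u r) : VRoot VRule.dB (LT.app a u) r := by
  obtain ⟨t, L, rfl, rfl⟩ := h.exists_fillLN
  exact .dB t u L

theorem SubVal.vRoot {t u r : LT} (h : SubVal t u r) : VRoot VRule.sV (LT.sub t u) r := by
  obtain ⟨v, L, hv, rfl, rfl⟩ := h.exists_fillLN
  exact .sV t v L hv

theorem DBeta.lift {a u r : LT} (h : DBeta a u r) (k : ℕ) :
    DBeta (lift k a) (lift k u) (lift k r) := by
  induction h generalizing k with
  | lam t u => exact .lam _ _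
  | sub b _ ih =>
    refine .sub _ ?_
    rw [LT.lift_lift _ (Nat.zero_le k)]
    exact ih (k + 1)

theorem DBeta.subst {a u r : LT} (h : DBeta a u r) (k : ℕ) (w : LT) :
    DBeta (subst a k w) (subst u k w) (subst r k w) := by
  induction h generalizing k with
  | lam t u => exact .lam _ _
  | sub b _ ih =>
    refine .sub _ ?_
    rw [← LT.subst_lift _ _ (Nat.zero_le k)]
    exact ih (k + 1)

theorem lift_subst_zero (t v : LT) (k : ℕ) :
    lift k (subst t 0 v) = subst (lift (k + 1) t) 0 (lift k v) := by
  simpa using LT.lift_subst t v 0 k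

theorem subst_subst_zero (t v w : LT) (k : ℕ) :
    subst (subst t 0 v) k w = subst (subst t (k + 1) w) 0 (subst v k w) := by
  simpa using LT.subst_subst t v w 0 k

theorem SubVal.lift {t u r : LT} (h : SubVal t u r) (k : ℕ) :
    SubVal (lift (k + 1) t) (lift k u) (lift k r) := by
  induction h generalizing k with
  | val t hv =>
    rw [lift_subst_zero]
    exact .val _ (hv.lift k)
  | sub b _ ih =>
    refine .sub _ ?_
    rw [LT.lift_lift _ (Nat.succ_le_succ (Nat.zero_le k))]
    exact ih (k + 1)

theorem SubVal.subst {t u r w : LT} (h : SubVal t u r) (hw : w.IsValue) (k : ℕ) :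
    SubVal (subst t (k + 1) w) (subst u k w) (subst r k w) := by
  induction h generalizing k with
  | val t hv =>
    rw [subst_subst_zero]
    exact .val _ (hv.subst hw k)
  | sub b _ ih =>
    refine .sub _ ?_
    rw [← LT.subst_lift _ _ (Nat.succ_le_succ (Nat.zero_le k))]
    exact ih (k + 1)

/-! ### Composition of contexts -/

namespace LCtx

/-- Composition of contexts. -/
def comp : LCtx → LCtx → LCtx
  | hole, D => D
  | appL C t, D => appL (comp C D) t
  | appR t C, D => appR t (comp C D)
  | lam C, D => lam (comp C D)
  | subL C t, D => subL (comp C D) t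
  | subR t C, D => subR t (comp C D)

theorem fill_comp (C D : LCtx) (s : LT) : (C.comp D).fill s = C.fill (D.fill s) := by
  induction C <;> simp_all [comp, fill]

theorem nSurface_comp (C D : LCtx) : (C.comp D).NSurface ↔ C.NSurface ∧ D.NSurface := by
  induction C <;> simp_all [comp, NSurface]

theorem vSurface_comp (C D : LCtx) : (C.comp D).VSurface ↔ C.VSurface ∧ D.VSurface := by
  induction C <;> simp_all [comp, VSurface]

end LCtx

open Relation (ReflTransGen)

/-- Abstract factorization: full steps are included in parallel steps `P`, which split as
surface steps followed by a parallel internal step; a parallel internal step followed by a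
surface step merges into a parallel step. -/
theorem factorization_of_split_of_merge {α : Type*} {F S J P : α → α → Prop}
    (hF : ∀ t u, F t u → P t u)
    (split : ∀ t u, P t u → ∃ s, ReflTransGen S t s ∧ J s u)
    (merge : ∀ t s u, J t s → S s u → P t u) {t u : α} (h : ReflTransGen F t u) :
    ∃ s, ReflTransGen S t s ∧ ReflTransGen J s u := by
  have swap : ∀ {s u : α}, ReflTransGen S s u → ∀ {t}, J t s →
      ∃ w, ReflTransGen S t w ∧ J w u := by
    intro s u h
    induction h using ReflTransGen.head_induction_on with
    | refl => exact fun h => ⟨_, .refl, h⟩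
    | head hs _ ih =>
      intro t ht
      obtain ⟨w, h₁, h₂⟩ := split _ _ (merge _ _ _ ht hs)
      obtain ⟨z, h₃, h₄⟩ := ih h₂
      exact ⟨z, h₁.trans h₃, h₄⟩
  induction h using ReflTransGen.head_induction_on with
  | refl => exact ⟨_, .refl, .refl⟩
  | head hs _ ih =>
    obtain ⟨s, h₁, h₂⟩ := ih
    obtain ⟨w, h₃, h₄⟩ := split _ _ (hF _ _ hs)
    obtain ⟨z, h₅, h₆⟩ := swap h₁ h₄
    exact ⟨z, h₃.trans h₅, .head h₆ h₂⟩

/-! ### Call-by-name -/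

theorem NFStep.fill {t u : LT} (h : NFStep t u) (C : LCtx) : NFStep (C.fill t) (C.fill u) := by
  obtain ⟨R, D, a, b, hab, rfl, rfl⟩ := h
  exact ⟨R, C.comp D, a, b, hab, (C.fill_comp D a).symm, (C.fill_comp D b).symm⟩

theorem NSStep.fill {t u : LT} (h : NSStep t u) {C : LCtx} (hC : C.NSurface) :
    NSStep (C.fill t) (C.fill u) := by
  obtain ⟨R, D, hD, a, b, hab, rfl, rfl⟩ := h
  exact ⟨R, C.comp D, (C.nSurface_comp D).2 ⟨hC, hD⟩, a, b, hab,
    (C.fill_comp D a).symm, (C.fill_comp D b).symm⟩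

theorem NIStep.fill {t u : LT} (h : NIStep t u) (C : LCtx) : NIStep (C.fill t) (C.fill u) := by
  obtain ⟨R, D, hD, a, b, hab, rfl, rfl⟩ := h
  exact ⟨R, C.comp D, fun h => hD ((C.nSurface_comp D).1 h).2, a, b, hab,
    (C.fill_comp D a).symm, (C.fill_comp D b).symm⟩

theorem NFStep.fill_internal {t u : LT} (h : NFStep t u) {C : LCtx} (hC : ¬ C.NSurface) :
    NIStep (C.fill t) (C.fill u) := by
  obtain ⟨R, D, a, b, hab, rfl, rfl⟩ := h
  exact ⟨R, C.comp D, fun h => hC ((C.nSurface_comp D).1 h).1, a, b, hab,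
    (C.fill_comp D a).symm, (C.fill_comp D b).symm⟩

theorem NSStep.nFStep {t u : LT} : NSStep t u → NFStep t u := fun ⟨R, C, _, h⟩ => ⟨R, C, h⟩

theorem NIStep.nFStep {t u : LT} : NIStep t u → NFStep t u := fun ⟨R, C, _, h⟩ => ⟨R, C, h⟩

theorem NRoot.nSStep {R : NRule} {a b : LT} (h : NRoot R a b) : NSStep a b :=
  ⟨R, .hole, trivial, a, b, h, rfl, rfl⟩

/-- CBN surface steps, as an inductive relation. -/
inductive NSurf : LT → LT → Prop
  | appL {a a' : LT} (u : LT) : NSurf a a' → NSurf (.app a u) (.app a' u)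
  | lam {a a' : LT} : NSurf a a' → NSurf (.lam a) (.lam a')
  | subL {a a' : LT} (u : LT) : NSurf a a' → NSurf (.sub a u) (.sub a' u)
  | dB {a u r : LT} : DBeta a u r → NSurf (.app a u) r
  | s (t u : LT) : NSurf (.sub t u) (subst t 0 u)

/-- CBN parallel reduction, contracting also the `dB`-redexes created on the way up. -/
inductive NPar : LT → LT → Prop
  | var (n : ℕ) : NPar (.var n) (.var n)
  | app {a a' u u' : LT} : NPar a a' → NPar u u' → NPar (.app a u) (.app a' u')
  | lam {a a' : LT} : NPar a a' → NPar (.lam a) (.lam a')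
  | sub {a a' u u' : LT} : NPar a a' → NPar u u' → NPar (.sub a u) (.sub a' u')
  | s {a a' u u' : LT} : NPar a a' → NPar u u' → NPar (.sub a u) (subst a' 0 u')
  | dB {a a' u u' r : LT} : NPar a a' → NPar u u' → DBeta a' u' r → NPar (.app a u) r

/-- CBN parallel internal reduction. -/
inductive NParInt : LT → LT → Prop
  | app {a a' u u' : LT} : NParInt a a' → NPar u u' → NParInt (.app a u) (.app a' u')
  | lam {a a' : LT} : NParInt a a' → NParInt (.lam a) (.lam a')
  | sub {a a' u u' : LT} : NParInt a a' → NPar u u' → NParInt (.sub a u) (.sub a' u')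
  | var (n : ℕ) : NParInt (.var n) (.var n)

/-- CBN surface reduction followed by a parallel internal step. -/
def NSplit (t u : LT) : Prop := ∃ s, ReflTransGen NSurf t s ∧ NParInt s u

theorem NSurf.nSStep {t u : LT} (h : NSurf t u) : NSStep t u := by
  induction h with
  | appL u _ ih => exact ih.fill (C := .appL .hole u) trivial
  | lam _ ih => exact ih.fill (C := .lam .hole) trivial
  | subL u _ ih => exact ih.fill (C := .subL .hole u) trivial
  | dB h => exact h.nRoot.nSStep
  | s t u => exact (NRoot.s t u).nSStep

theorem NSurf.lift {t u : LT} (h : NSurf t u) (k : ℕ) : NSurf (lift k t) (lift k u) := by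
  induction h generalizing k with
  | appL u _ ih => exact .appL _ (ih k)
  | lam _ ih => exact .lam (ih _)
  | subL u _ ih => exact .subL _ (ih _)
  | dB h => exact .dB (h.lift k)
  | s t u => rw [lift_subst_zero]; exact .s _ _

theorem NSurf.subst {t u : LT} (h : NSurf t u) (k : ℕ) (w : LT) :
    NSurf (subst t k w) (subst u k w) := by
  induction h generalizing k with
  | appL u _ ih => exact .appL _ (ih k)
  | lam _ ih => exact .lam (ih _)
  | subL u _ ih => exact .subL _ (ih _)
  | dB h => exact .dB (h.subst k w)
  | s t u => rw [subst_subst_zero]; exact .s _ _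

theorem NPar.refl (t : LT) : NPar t t := by
  induction t with
  | var n => exact .var n
  | app a b iha ihb => exact .app iha ihb
  | lam a ih => exact .lam ih
  | sub a b iha ihb => exact .sub iha ihb

theorem NPar.lift {t u : LT} (h : NPar t u) (k : ℕ) : NPar (lift k t) (lift k u) := by
  induction h generalizing k with
  | var n => exact .refl _
  | app _ _ iha ihu => exact .app (iha k) (ihu k)
  | lam _ ih => exact .lam (ih _)
  | sub _ _ iha ihu => exact .sub (iha _) (ihu k)
  | dB _ _ h iha ihu => exact .dB (iha k) (ihu k) (h.lift k)
  | s _ _ iha ihu => rw [lift_subst_zero]; exact .s (iha _) (ihu k)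

theorem NPar.liftN {t u : LT} (h : NPar t u) (k : ℕ) : NPar (liftN k t) (liftN k u) := by
  induction k with
  | zero => exact h
  | succ k ih => simpa only [LT.liftN_succ] using ih.lift 0

theorem NPar.subst {t t' w w' : LT} (h : NPar t t') (hw : NPar w w') (k : ℕ) :
    NPar (subst t k w) (subst t' k w') := by
  induction h generalizing k with
  | var n =>
    simp only [LT.subst]
    split_ifs
    · exact .refl _
    · exact hw.liftN k
    · exact .refl _
  | app _ _ iha ihu => exact .app (iha k) (ihu k)
  | lam _ ih => exact .lam (ih _)
  | sub _ _ iha ihu => exact .sub (iha _) (ihu k)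
  | dB _ _ h iha ihu => exact .dB (iha k) (ihu k) (h.subst k w')
  | s _ _ iha ihu => rw [subst_subst_zero]; exact .s (iha _) (ihu k)

theorem NFStep.nPar {t u : LT} (h : NFStep t u) : NPar t u := by
  obtain ⟨R, C, a, b, hab, rfl, rfl⟩ := h
  induction C with
  | hole =>
    cases hab with
    | dB t u L => exact .dB (.refl _) (.refl _) (dBeta_fillLN t u L)
    | s t u => exact .s (.refl _) (.refl _)
  | appL C t ih => exact .app ih (.refl _)
  | appR t C ih => exact .app (.refl _) ih
  | lam C ih => exact .lam ih
  | subL C t ih => exact .sub ih (.refl _)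
  | subR t C ih => exact .sub (.refl _) ih

theorem NPar.reflTransGen {t u : LT} (h : NPar t u) : ReflTransGen NFStep t u := by
  have lift : ∀ (C : LCtx) {a b : LT}, ReflTransGen NFStep a b →
      ReflTransGen NFStep (C.fill a) (C.fill b) :=
    fun C _ _ h => h.lift C.fill fun _ _ h => h.fill C
  have app : ∀ {a a' u u' : LT}, ReflTransGen NFStep a a' → ReflTransGen NFStep u u' →
      ReflTransGen NFStep (.app a u) (.app a' u') :=
    fun h₁ h₂ => (lift (.appL .hole _) h₁).trans (lift (.appR _ .hole) h₂)
  have sub : ∀ {a a' u u' : LT}, ReflTransGen NFStep a a' → ReflTransGen NFStep u u' →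
      ReflTransGen NFStep (.sub a u) (.sub a' u') :=
    fun h₁ h₂ => (lift (.subL .hole _) h₁).trans (lift (.subR _ .hole) h₂)
  induction h with
  | var n => exact .refl
  | app _ _ iha ihu => exact app iha ihu
  | lam _ ih => exact lift (.lam .hole) ih
  | sub _ _ iha ihu => exact sub iha ihu
  | dB _ _ h iha ihu => exact (app iha ihu).tail h.nRoot.nSStep.nFStep
  | s _ _ iha ihu => exact (sub iha ihu).tail (NRoot.s _ _).nSStep.nFStep

theorem NParInt.reflTransGen {t u : LT} (h : NParInt t u) : ReflTransGen NIStep t u := by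
  have lift : ∀ (C : LCtx) {a b : LT}, ReflTransGen NIStep a b →
      ReflTransGen NIStep (C.fill a) (C.fill b) :=
    fun C _ _ h => h.lift C.fill fun _ _ h => h.fill C
  induction h with
  | var n => exact .refl
  | app _ hu iha =>
    exact (lift (.appL .hole _) iha).trans <| hu.reflTransGen.lift (LT.app _)
      fun _ _ h => h.fill_internal (C := .appR _ .hole) id
  | lam _ ih => exact lift (.lam .hole) ih
  | sub _ hu iha =>
    exact (lift (.subL .hole _) iha).trans <| hu.reflTransGen.lift (LT.sub _)
      fun _ _ h => h.fill_internal (C := .subR _ .hole) id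

theorem NParInt.nPar {t u : LT} (h : NParInt t u) : NPar t u := by
  induction h with
  | var n => exact .var n
  | app _ hu iha => exact .app iha hu
  | lam _ ih => exact .lam ih
  | sub _ hu iha => exact .sub iha hu

theorem NParInt.refl (t : LT) : NParInt t t := by
  induction t with
  | var n => exact .var n
  | app a b iha _ => exact .app iha (.refl b)
  | lam a ih => exact .lam ih
  | sub a b iha _ => exact .sub iha (.refl b)

theorem NParInt.lift {t u : LT} (h : NParInt t u) (k : ℕ) : NParInt (lift k t) (lift k u) := by
  induction h generalizing k with
  | var n => exact .refl _
  | app _ hu iha => exact .app (iha k) (hu.lift k)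
  | lam _ ih => exact .lam (ih _)
  | sub _ hu iha => exact .sub (iha _) (hu.lift k)

theorem NSplit.app {a a' u u' : LT} (h : NSplit a a') (hu : NPar u u') :
    NSplit (.app a u) (.app a' u') := by
  obtain ⟨s, h₁, h₂⟩ := h
  exact ⟨.app s u, h₁.lift (LT.app · u) fun _ _ h => .appL u h, .app h₂ hu⟩

theorem NSplit.lam {a a' : LT} (h : NSplit a a') : NSplit (.lam a) (.lam a') := by
  obtain ⟨s, h₁, h₂⟩ := h
  exact ⟨.lam s, h₁.lift LT.lam fun _ _ h => .lam h, .lam h₂⟩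

theorem NSplit.sub {a a' u u' : LT} (h : NSplit a a') (hu : NPar u u') :
    NSplit (.sub a u) (.sub a' u') := by
  obtain ⟨s, h₁, h₂⟩ := h
  exact ⟨.sub s u, h₁.lift (LT.sub · u) fun _ _ h => .subL u h, .sub h₂ hu⟩

theorem NSplit.liftN {t u : LT} (h : NSplit t u) (k : ℕ) : NSplit (liftN k t) (liftN k u) := by
  induction k with
  | zero => exact h
  | succ k ih =>
    obtain ⟨s, h₁, h₂⟩ := ih
    rw [LT.liftN_succ, LT.liftN_succ]
    exact ⟨lift 0 s, h₁.lift (lift 0) fun _ _ h => h.lift 0, h₂.lift 0⟩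

theorem NParInt.subst_split {t t' w w' : LT} (h : NParInt t t') (hw : NPar w w')
    (hs : NSplit w w') (k : ℕ) : NSplit (subst t k w) (subst t' k w') := by
  induction h generalizing k with
  | var n =>
    simp only [LT.subst]
    split_ifs
    · exact ⟨_, .refl, .refl _⟩
    · exact hs.liftN k
    · exact ⟨_, .refl, .refl _⟩
  | app _ hu iha => exact (iha k).app (hu.subst hw k)
  | lam _ ih => exact (ih _).lam
  | sub _ hu iha => exact (iha _).sub (hu.subst hw k)

theorem DBeta.pullback_nParInt {a a' u u' r : LT} (hr : DBeta a' u' r) (ha : NParInt a a')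
    (hu : NPar u u') : ∃ r₁, DBeta a u r₁ ∧ NParInt r₁ r := by
  induction hr generalizing a u with
  | lam t u' =>
    cases ha with
    | lam ht => exact ⟨_, .lam _ _, .sub ht hu⟩
  | sub b _ ih =>
    cases ha with
    | sub ha hb =>
      obtain ⟨r₁, h₁, h₂⟩ := ih ha (hu.lift 0)
      exact ⟨_, .sub _ h₁, .sub h₂ hb⟩

theorem NPar.split {t u : LT} (h : NPar t u) : NSplit t u := by
  induction h with
  | var n => exact ⟨_, .refl, .var n⟩
  | app _ hu iha _ => exact iha.app hu
  | lam _ ih => exact ih.lam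
  | sub _ hu iha _ => exact iha.sub hu
  | @dB a a' u u' r _ hu hr iha _ =>
    obtain ⟨s, h₁, h₂⟩ := iha
    obtain ⟨r₁, h₃, h₄⟩ := hr.pullback_nParInt h₂ hu
    exact ⟨r₁, (h₁.lift (LT.app · u) fun _ _ h => .appL u h).tail (.dB h₃), h₄⟩
  | @s a a' u u' _ hu iha ihu =>
    obtain ⟨s, h₁, h₂⟩ := iha
    obtain ⟨z, h₃, h₄⟩ := h₂.subst_split hu ihu 0
    exact ⟨z, ((h₁.lift (LT.sub · u) fun _ _ h => .subL u h).tail (.s s u)).trans h₃, h₄⟩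

theorem NParInt.merge {t s u : LT} (h : NParInt t s) (hs : NSurf s u) : NPar t u := by
  induction hs generalizing t with
  | appL u _ ih => cases h with | app ha hu => exact .app (ih ha) hu
  | lam _ ih => cases h with | lam ha => exact .lam (ih ha)
  | subL u _ ih => cases h with | sub ha hu => exact .sub (ih ha) hu
  | dB hr => cases h with | app ha hu => exact .dB ha.nPar hu hr
  | s t u => cases h with | sub ha hu => exact .s ha.nPar hu

theorem nFStep_factorization (t u : LT) : ReflTransGen NFStep t u ↔
    ∃ s, ReflTransGen NSStep t s ∧ ReflTransGen NIStep s u := by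
  constructor
  · intro h
    obtain ⟨s, h₁, h₂⟩ :=
      factorization_of_split_of_merge (F := NFStep) (S := NSurf) (J := NParInt)
        (P := NPar) (fun _ _ h => h.nPar) (fun _ _ h => h.split) (fun _ _ _ h => h.merge) h
    exact ⟨s, h₁.lift id fun _ _ h => h.nSStep,
      Relation.reflTransGen_closed (fun _ _ h => h.reflTransGen) _ _ h₂⟩
  · rintro ⟨s, h₁, h₂⟩
    exact (h₁.lift id fun _ _ h => h.nFStep).trans (h₂.lift id fun _ _ h => h.nFStep)

/-! ### Call-by-value -/

theorem VFStep.fill {t u : LT} (h : VFStep t u) (C : LCtx) : VFStep (C.fill t) (C.fill u) := by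
  obtain ⟨R, D, a, b, hab, rfl, rfl⟩ := h
  exact ⟨R, C.comp D, a, b, hab, (C.fill_comp D a).symm, (C.fill_comp D b).symm⟩

theorem VSStep.fill {t u : LT} (h : VSStep t u) {C : LCtx} (hC : C.VSurface) :
    VSStep (C.fill t) (C.fill u) := by
  obtain ⟨R, D, hD, a, b, hab, rfl, rfl⟩ := h
  exact ⟨R, C.comp D, (C.vSurface_comp D).2 ⟨hC, hD⟩, a, b, hab,
    (C.fill_comp D a).symm, (C.fill_comp D b).symm⟩

theorem VIStep.fill {t u : LT} (h : VIStep t u) (C : LCtx) : VIStep (C.fill t) (C.fill u) := by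
  obtain ⟨R, D, hD, a, b, hab, rfl, rfl⟩ := h
  exact ⟨R, C.comp D, fun h => hD ((C.vSurface_comp D).1 h).2, a, b, hab,
    (C.fill_comp D a).symm, (C.fill_comp D b).symm⟩

theorem VFStep.fill_internal {t u : LT} (h : VFStep t u) {C : LCtx} (hC : ¬ C.VSurface) :
    VIStep (C.fill t) (C.fill u) := by
  obtain ⟨R, D, a, b, hab, rfl, rfl⟩ := h
  exact ⟨R, C.comp D, fun h => hC ((C.vSurface_comp D).1 h).1, a, b, hab,
    (C.fill_comp D a).symm, (C.fill_comp D b).symm⟩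

theorem VSStep.vFStep {t u : LT} : VSStep t u → VFStep t u := fun ⟨R, C, _, h⟩ => ⟨R, C, h⟩

theorem VIStep.vFStep {t u : LT} : VIStep t u → VFStep t u := fun ⟨R, C, _, h⟩ => ⟨R, C, h⟩

theorem VRoot.vSStep {R : VRule} {a b : LT} (h : VRoot R a b) : VSStep a b :=
  ⟨R, .hole, trivial, a, b, h, rfl, rfl⟩

/-- CBV surface steps, as an inductive relation. -/
inductive VSurf : LT → LT → Prop
  | appL {a a' : LT} (u : LT) : VSurf a a' → VSurf (.app a u) (.app a' u)
  | appR (a : LT) {u u' : LT} : VSurf u u' → VSurf (.app a u) (.app a u')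
  | subL {a a' : LT} (u : LT) : VSurf a a' → VSurf (.sub a u) (.sub a' u)
  | subR (a : LT) {u u' : LT} : VSurf u u' → VSurf (.sub a u) (.sub a u')
  | dB {a u r : LT} : DBeta a u r → VSurf (.app a u) r
  | sV {t u r : LT} : SubVal t u r → VSurf (.sub t u) r

/-- CBV parallel reduction, contracting also the redexes created on the way up. -/
inductive VPar : LT → LT → Prop
  | var (n : ℕ) : VPar (.var n) (.var n)
  | app {a a' u u' : LT} : VPar a a' → VPar u u' → VPar (.app a u) (.app a' u')
  | lam {a a' : LT} : VPar a a' → VPar (.lam a) (.lam a')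
  | sub {a a' u u' : LT} : VPar a a' → VPar u u' → VPar (.sub a u) (.sub a' u')
  | dB {a a' u u' r : LT} : VPar a a' → VPar u u' → DBeta a' u' r → VPar (.app a u) r
  | sV {a a' u u' r : LT} : VPar a a' → VPar u u' → SubVal a' u' r → VPar (.sub a u) r

/-- CBV parallel internal reduction; the parallel step under an abstraction comes with a
decomposition as surface steps followed by a parallel internal step. -/
inductive VParInt : LT → LT → Prop
  | var (n : ℕ) : VParInt (.var n) (.var n)
  | app {a a' u u' : LT} : VParInt a a' → VParInt u u' → VParInt (.app a u) (.app a' u')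
  | lam {a s a' : LT} : VPar a a' → ReflTransGen VSurf a s → VParInt s a' →
      VParInt (.lam a) (.lam a')
  | sub {a a' u u' : LT} : VParInt a a' → VParInt u u' → VParInt (.sub a u) (.sub a' u')

theorem VSurf.vSStep {t u : LT} (h : VSurf t u) : VSStep t u := by
  induction h with
  | appL u _ ih => exact ih.fill (C := .appL .hole u) trivial
  | appR a _ ih => exact ih.fill (C := .appR a .hole) trivial
  | subL u _ ih => exact ih.fill (C := .subL .hole u) trivial
  | subR a _ ih => exact ih.fill (C := .subR a .hole) trivial
  | dB h => exact h.vRoot.vSStep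
  | sV h => exact h.vRoot.vSStep

theorem VSurf.lift {t u : LT} (h : VSurf t u) (k : ℕ) : VSurf (lift k t) (lift k u) := by
  induction h generalizing k with
  | appL u _ ih => exact .appL _ (ih k)
  | appR a _ ih => exact .appR _ (ih k)
  | subL u _ ih => exact .subL _ (ih _)
  | subR a _ ih => exact .subR _ (ih k)
  | dB h => exact .dB (h.lift k)
  | sV h => exact .sV (h.lift k)

theorem VSurf.subst {t u w : LT} (h : VSurf t u) (hw : w.IsValue) (k : ℕ) :
    VSurf (subst t k w) (subst u k w) := by
  induction h generalizing k with
  | appL u _ ih => exact .appL _ (ih k)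
  | appR a _ ih => exact .appR _ (ih k)
  | subL u _ ih => exact .subL _ (ih _)
  | subR a _ ih => exact .subR _ (ih k)
  | dB h => exact .dB (h.subst k w)
  | sV h => exact .sV (h.subst hw k)

theorem VSurf.reflTransGen_app {a a' u u' : LT} (ha : ReflTransGen VSurf a a')
    (hu : ReflTransGen VSurf u u') : ReflTransGen VSurf (.app a u) (.app a' u') :=
  (ha.lift (LT.app · u) fun _ _ h => .appL u h).trans
    (hu.lift (LT.app a') fun _ _ h => .appR a' h)

theorem VSurf.reflTransGen_sub {a a' u u' : LT} (ha : ReflTransGen VSurf a a')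
    (hu : ReflTransGen VSurf u u') : ReflTransGen VSurf (.sub a u) (.sub a' u') :=
  (ha.lift (LT.sub · u) fun _ _ h => .subL u h).trans
    (hu.lift (LT.sub a') fun _ _ h => .subR a' h)

theorem VPar.refl (t : LT) : VPar t t := by
  induction t with
  | var n => exact .var n
  | app a b iha ihb => exact .app iha ihb
  | lam a ih => exact .lam ih
  | sub a b iha ihb => exact .sub iha ihb

theorem VPar.lift {t u : LT} (h : VPar t u) (k : ℕ) : VPar (lift k t) (lift k u) := by
  induction h generalizing k with
  | var n => exact .refl _
  | app _ _ iha ihu => exact .app (iha k) (ihu k)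
  | lam _ ih => exact .lam (ih _)
  | sub _ _ iha ihu => exact .sub (iha _) (ihu k)
  | dB _ _ h iha ihu => exact .dB (iha k) (ihu k) (h.lift k)
  | sV _ _ h iha ihu => exact .sV (iha _) (ihu k) (h.lift k)

theorem VPar.liftN {t u : LT} (h : VPar t u) (k : ℕ) : VPar (liftN k t) (liftN k u) := by
  induction k with
  | zero => exact h
  | succ k ih => simpa only [LT.liftN_succ] using ih.lift 0

theorem VPar.subst {t t' w w' : LT} (h : VPar t t') (hw : VPar w w') (hw' : w'.IsValue)
    (k : ℕ) : VPar (subst t k w) (subst t' k w') := by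
  induction h generalizing k with
  | var n =>
    simp only [LT.subst]
    split_ifs
    · exact .refl _
    · exact hw.liftN k
    · exact .refl _
  | app _ _ iha ihu => exact .app (iha k) (ihu k)
  | lam _ ih => exact .lam (ih _)
  | sub _ _ iha ihu => exact .sub (iha _) (ihu k)
  | dB _ _ h iha ihu => exact .dB (iha k) (ihu k) (h.subst k w')
  | sV _ _ h iha ihu => exact .sV (iha _) (ihu k) (h.subst hw' k)

theorem VFStep.vPar {t u : LT} (h : VFStep t u) : VPar t u := by
  obtain ⟨R, C, a, b, hab, rfl, rfl⟩ := h
  induction C with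
  | hole =>
    cases hab with
    | dB t u L => exact .dB (.refl _) (.refl _) (dBeta_fillLN t u L)
    | sV t v L hv => exact .sV (.refl _) (.refl _) (subVal_fillLN t hv L)
  | appL C t ih => exact .app ih (.refl _)
  | appR t C ih => exact .app (.refl _) ih
  | lam C ih => exact .lam ih
  | subL C t ih => exact .sub ih (.refl _)
  | subR t C ih => exact .sub (.refl _) ih

theorem VPar.reflTransGen {t u : LT} (h : VPar t u) : ReflTransGen VFStep t u := by
  have lift : ∀ (C : LCtx) {a b : LT}, ReflTransGen VFStep a b →
      ReflTransGen VFStep (C.fill a) (C.fill b) :=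
    fun C _ _ h => h.lift C.fill fun _ _ h => h.fill C
  have app : ∀ {a a' u u' : LT}, ReflTransGen VFStep a a' → ReflTransGen VFStep u u' →
      ReflTransGen VFStep (.app a u) (.app a' u') :=
    fun h₁ h₂ => (lift (.appL .hole _) h₁).trans (lift (.appR _ .hole) h₂)
  have sub : ∀ {a a' u u' : LT}, ReflTransGen VFStep a a' → ReflTransGen VFStep u u' →
      ReflTransGen VFStep (.sub a u) (.sub a' u') :=
    fun h₁ h₂ => (lift (.subL .hole _) h₁).trans (lift (.subR _ .hole) h₂)
  induction h with
  | var n => exact .refl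
  | app _ _ iha ihu => exact app iha ihu
  | lam _ ih => exact lift (.lam .hole) ih
  | sub _ _ iha ihu => exact sub iha ihu
  | dB _ _ h iha ihu => exact (app iha ihu).tail h.vRoot.vSStep.vFStep
  | sV _ _ h iha ihu => exact (sub iha ihu).tail h.vRoot.vSStep.vFStep

theorem VParInt.reflTransGen {t u : LT} (h : VParInt t u) : ReflTransGen VIStep t u := by
  have lift : ∀ (C : LCtx) {a b : LT}, ReflTransGen VIStep a b →
      ReflTransGen VIStep (C.fill a) (C.fill b) :=
    fun C _ _ h => h.lift C.fill fun _ _ h => h.fill C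
  induction h with
  | var n => exact .refl
  | app _ _ iha ihu => exact (lift (.appL .hole _) iha).trans (lift (.appR _ .hole) ihu)
  | lam ha _ _ _ =>
    exact ha.reflTransGen.lift LT.lam fun _ _ h => h.fill_internal (C := .lam .hole) id
  | sub _ _ iha ihu => exact (lift (.subL .hole _) iha).trans (lift (.subR _ .hole) ihu)

theorem VParInt.vPar {t u : LT} (h : VParInt t u) : VPar t u := by
  induction h with
  | var n => exact .var n
  | app _ _ iha ihu => exact .app iha ihu
  | lam ha _ _ _ => exact .lam ha
  | sub _ _ iha ihu => exact .sub iha ihu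

theorem VParInt.refl (t : LT) : VParInt t t := by
  induction t with
  | var n => exact .var n
  | app a b iha ihb => exact .app iha ihb
  | lam a ih => exact .lam (.refl a) .refl ih
  | sub a b iha ihb => exact .sub iha ihb

theorem VParInt.lift {t u : LT} (h : VParInt t u) (k : ℕ) : VParInt (lift k t) (lift k u) := by
  induction h generalizing k with
  | var n => exact .refl _
  | app _ _ iha ihu => exact .app (iha k) (ihu k)
  | lam ha hs _ ih =>
    exact .lam (ha.lift _) (hs.lift (LT.lift (k + 1)) fun _ _ h => h.lift _) (ih _)
  | sub _ _ iha ihu => exact .sub (iha _) (ihu k)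

theorem VParInt.liftN {t u : LT} (h : VParInt t u) (k : ℕ) :
    VParInt (liftN k t) (liftN k u) := by
  induction k with
  | zero => exact h
  | succ k ih => simpa only [LT.liftN_succ] using ih.lift 0

theorem VParInt.isValue {t u : LT} (h : VParInt t u) (hu : u.IsValue) : t.IsValue := by
  cases h with
  | var n => trivial
  | lam _ _ _ => trivial
  | app _ _ => exact hu.elim
  | sub _ _ => exact hu.elim

theorem VParInt.subst {t t' w w' : LT} (h : VParInt t t') (hw : VParInt w w')
    (hw' : w'.IsValue) (k : ℕ) : VParInt (subst t k w) (subst t' k w') := by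
  induction h generalizing k with
  | var n =>
    simp only [LT.subst]
    split_ifs
    · exact .refl _
    · exact hw.liftN k
    · exact .refl _
  | app _ _ iha ihu => exact .app (iha k) (ihu k)
  | lam ha hs _ ih =>
    exact .lam (ha.subst hw.vPar hw' _)
      (hs.lift (LT.subst · (k + 1) w) fun _ _ h => h.subst (hw.isValue hw') _) (ih _)
  | sub _ _ iha ihu => exact .sub (iha _) (ihu k)

theorem DBeta.pullback_vParInt {a a' u u' r : LT} (hr : DBeta a' u' r) (ha : VParInt a a')
    (hu : VParInt u u') :
    ∃ r₁ r₂, DBeta a u r₁ ∧ ReflTransGen VSurf r₁ r₂ ∧ VParInt r₂ r := by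
  induction hr generalizing a u with
  | lam t u' =>
    cases ha with
    | lam _ hs ht => exact ⟨_, _, .lam _ _, VSurf.reflTransGen_sub hs .refl, .sub ht hu⟩
  | sub b _ ih =>
    cases ha with
    | sub ha hb =>
      obtain ⟨r₁, r₂, h₁, h₂, h₃⟩ := ih ha (hu.lift 0)
      exact ⟨_, _, .sub _ h₁, VSurf.reflTransGen_sub h₂ .refl, .sub h₃ hb⟩

theorem SubVal.pullback_vParInt {t t' u u' r : LT} (hr : SubVal t' u' r) (ht : VParInt t t')
    (hu : VParInt u u') : ∃ r₁, SubVal t u r₁ ∧ VParInt r₁ r := by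
  induction hr generalizing t u with
  | val t' hv => exact ⟨_, .val t (hu.isValue hv), ht.subst hu hv 0⟩
  | sub b _ ih =>
    cases hu with
    | sub ha hb =>
      obtain ⟨r₁, h₁, h₂⟩ := ih (ht.lift 1) ha
      exact ⟨_, .sub _ h₁, .sub h₂ hb⟩

theorem VPar.split {t u : LT} (h : VPar t u) : ∃ s, ReflTransGen VSurf t s ∧ VParInt s u := by
  induction h with
  | var n => exact ⟨_, .refl, .var n⟩
  | app _ _ iha ihu =>
    obtain ⟨s, h₁, h₂⟩ := iha
    obtain ⟨z, h₃, h₄⟩ := ihu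
    exact ⟨_, VSurf.reflTransGen_app h₁ h₃, .app h₂ h₄⟩
  | lam ha ih =>
    obtain ⟨s, h₁, h₂⟩ := ih
    exact ⟨_, .refl, .lam ha h₁ h₂⟩
  | sub _ _ iha ihu =>
    obtain ⟨s, h₁, h₂⟩ := iha
    obtain ⟨z, h₃, h₄⟩ := ihu
    exact ⟨_, VSurf.reflTransGen_sub h₁ h₃, .sub h₂ h₄⟩
  | dB _ _ hr iha ihu =>
    obtain ⟨s, h₁, h₂⟩ := iha
    obtain ⟨z, h₃, h₄⟩ := ihu
    obtain ⟨r₁, r₂, h₅, h₆, h₇⟩ := hr.pullback_vParInt h₂ h₄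
    exact ⟨r₂, ((VSurf.reflTransGen_app h₁ h₃).tail (.dB h₅)).trans h₆, h₇⟩
  | sV _ _ hr iha ihu =>
    obtain ⟨s, h₁, h₂⟩ := iha
    obtain ⟨z, h₃, h₄⟩ := ihu
    obtain ⟨r₁, h₅, h₆⟩ := hr.pullback_vParInt h₂ h₄
    exact ⟨r₁, (VSurf.reflTransGen_sub h₁ h₃).tail (.sV h₅), h₆⟩

theorem VParInt.merge {t s u : LT} (h : VParInt t s) (hs : VSurf s u) : VPar t u := by
  induction hs generalizing t with
  | appL u _ ih => cases h with | app ha hu => exact .app (ih ha) hu.vPar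
  | appR a _ ih => cases h with | app ha hu => exact .app ha.vPar (ih hu)
  | subL u _ ih => cases h with | sub ha hu => exact .sub (ih ha) hu.vPar
  | subR a _ ih => cases h with | sub ha hu => exact .sub ha.vPar (ih hu)
  | dB hr => cases h with | app ha hu => exact .dB ha.vPar hu.vPar hr
  | sV hr => cases h with | sub ha hu => exact .sV ha.vPar hu.vPar hr

theorem vFStep_factorization (t u : LT) : ReflTransGen VFStep t u ↔
    ∃ s, ReflTransGen VSStep t s ∧ ReflTransGen VIStep s u := by
  constructor
  · intro h
    obtain ⟨s, h₁, h₂⟩ :=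
      factorization_of_split_of_merge (F := VFStep) (S := VSurf) (J := VParInt)
        (P := VPar) (fun _ _ h => h.vPar) (fun _ _ h => h.split) (fun _ _ _ h => h.merge) h
    exact ⟨s, h₁.lift id fun _ _ h => h.vSStep,
      Relation.reflTransGen_closed (fun _ _ h => h.reflTransGen) _ _ h₂⟩
  · rintro ⟨s, h₁, h₂⟩
    exact (h₁.lift id fun _ _ h => h.vFStep).trans (h₂.lift id fun _ _ h => h.vFStep)

/-- **Factorization for CBN and CBV.**  In the CBN calculus `→ⁿF* = →ⁿS* ∘ →ⁿI*`, and
in the CBV calculus `→ᵛF* = →ᵛS* ∘ →ᵛI*`: every full reduction sequence can be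
rearranged into a surface sequence followed by an internal one, with the same start and
end terms. -/
theorem cbn_cbv_factorization :
    (∀ t u : LT, Relation.ReflTransGen NFStep t u ↔
      ∃ s, Relation.ReflTransGen NSStep t s ∧ Relation.ReflTransGen NIStep s u) ∧
    (∀ t u : LT, Relation.ReflTransGen VFStep t u ↔
      ∃ s, Relation.ReflTransGen VSStep t s ∧ Relation.ReflTransGen VIStep s u) :=
  ⟨nFStep_factorization, vFStep_factorization⟩

end BangPaper
end
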